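/- arXiv:1507.08425 — 3 statements merged into one kernel-verified Lean document; each statement's English description precedes it below -/
import Mathlib

section
/- Let n, y, h be real numbers with n > 0, 0 ≤ y ≤ 1/2, n/2 ≤ h, and h ≤ n. Then the two-dimensional Lebesgue measure of the set {(x₁, x₂) ∈ [0,n] × [0,n] : x₁·y + x₂·(1−y) ≤ h} is at least n·h. -/
open MeasureTheory Set

/-- The area under the graph of an affine function on `[0, n]` is `n` times its midpoint value. -/
theorem volume_regionBetween_zero_affine {n h s : ℝ} (hn : 0 ≤ n)
    (hpos : ∀ x ∈ Icc (0 : ℝ) n, 0 ≤ h + s * (n / 2 - x)) :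
    volume (regionBetween (fun _ => (0 : ℝ)) (fun x => h + s * (n / 2 - x)) (Icc 0 n)) =
      ENNReal.ofReal (n * h) := by
  have hcont : Continuous fun x : ℝ => h + s * (n / 2 - x) := by fun_prop
  rw [Measure.volume_eq_prod, volume_regionBetween_eq_integral continuous_const.integrableOn_Icc
    hcont.integrableOn_Icc measurableSet_Icc hpos]
  congr 1
  rw [integral_Icc_eq_integral_Ioc, ← intervalIntegral.integral_of_le hn]
  simp only [Pi.sub_apply, sub_zero]
  have hderiv : ∀ x ∈ uIcc 0 n, HasDerivAt (fun x : ℝ => h * x + s * (n / 2 * x - x ^ 2 / 2))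
      (h + s * (n / 2 - x)) x := by
    intro x _
    have hd := ((hasDerivAt_id x).const_mul h).add
      ((((hasDerivAt_id x).const_mul (n / 2)).sub (((hasDerivAt_id x).pow 2).div_const 2)).const_mul s)
    exact hd.congr_deriv (by norm_num)
  rw [intervalIntegral.integral_eq_sub_of_hasDerivAt hderiv
    (hcont.intervalIntegrable _ _)]
  ring

theorem polygon_area_ge (n y h : ℝ) (hn : 0 < n) (hy0 : 0 ≤ y) (hy1 : y ≤ 1 / 2)
    (h1 : n / 2 ≤ h) (h2 : h ≤ n) :
    ENNReal.ofReal (n * h) ≤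
      volume {p : ℝ × ℝ | p.1 ∈ Icc (0:ℝ) n ∧ p.2 ∈ Icc (0:ℝ) n ∧
        p.1 * y + p.2 * (1 - y) ≤ h} := by
  -- The line through `(n / 2, h)` and the point where the cutting line meets `x₁ = n`
  -- bounds a trapezium of area `n * h` inside the polygon.
  have hy : 0 < 1 - y := by linarith
  obtain ⟨s, hs⟩ : ∃ s : ℝ, s * n * (1 - y) = 2 * y * (n - h) :=
    ⟨2 * y * (n - h) / (n * (1 - y)), by field_simp⟩
  have hs0 : 0 ≤ s := by
    have : 0 ≤ s * (n * (1 - y)) := by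
      rw [← mul_assoc, hs]
      exact mul_nonneg (by positivity) (by linarith)
    exact nonneg_of_mul_nonneg_left this (by positivity)
  have hsn : s * n ≤ 2 * (n - h) := by
    refine le_of_mul_le_mul_right ?_ hy
    nlinarith
  rw [← volume_regionBetween_zero_affine (s := s) hn.le]
  · refine measure_mono ?_
    rintro ⟨x, z⟩ ⟨hx, hz0, hz⟩
    dsimp only at hx hz0 hz
    refine ⟨hx, ⟨hz0.le, ?_⟩, ?_⟩ <;> dsimp only
    · nlinarith [mul_nonneg hs0 hx.1]
    · have hcut : x * y + (h + s * (n / 2 - x)) * (1 - y) ≤ h := by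
        refine le_of_mul_le_mul_right ?_ hn
        have hslack : 0 ≤ y * ((n - x) * (2 * h - n)) :=
          mul_nonneg hy0 (mul_nonneg (by linarith [hx.2]) (by linarith))
        linear_combination hslack + (n / 2 - x) * hs
      nlinarith
  · intro x hx
    nlinarith [mul_nonneg hs0 (sub_nonneg.2 hx.2)]
end

section
/- Let n be a positive integer, let y be a real number with 0 ≤ y ≤ 1, and let h be a real number. Let A denote the two-dimensional Lebesgue measure of the set {(x₁, x₂) ∈ [0,n] × [0,n] : x₁·y + x₂·(1−y) ≤ h}. Then the number of pairs of integers (i, j) with 1 ≤ i ≤ n, 1 ≤ j ≤ n, and i·y + j·(1−y) ≤ h is at least A − 2·n. -/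
open MeasureTheory Set
open scoped Classical

/-- A subset of `[0, n]²` whose points with both coordinates at least `1` have their coordinatewise
floor in `s` is covered by two `1 × n` strips and one unit square for each element of `s`. -/
theorem volume_le_card_add_of_floor_mem {n : ℕ} {S : Set (ℝ × ℝ)} {s : Finset (ℕ × ℕ)}
    (hS : S ⊆ Icc 0 (n : ℝ) ×ˢ Icc 0 (n : ℝ))
    (hs : ∀ p ∈ S, 1 ≤ p.1 → 1 ≤ p.2 → (⌊p.1⌋₊, ⌊p.2⌋₊) ∈ s) :
    volume S ≤ ((n + n + s.card : ℕ) : ENNReal) := by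
  have hcover : S ⊆ (Icc 0 1 ×ˢ Icc 0 (n : ℝ) ∪ Icc 0 (n : ℝ) ×ˢ Icc 0 1) ∪
      ⋃ q ∈ s, Ico (q.1 : ℝ) (q.1 + 1) ×ˢ Ico (q.2 : ℝ) (q.2 + 1) := by
    intro p hp
    obtain ⟨h1, h2⟩ := hS hp
    rcases le_total p.1 1 with hp1 | hp1
    · exact Or.inl (Or.inl ⟨⟨h1.1, hp1⟩, h2⟩)
    rcases le_total p.2 1 with hp2 | hp2
    · exact Or.inl (Or.inr ⟨h1, h2.1, hp2⟩)
    · exact Or.inr (mem_iUnion₂.2 ⟨_, hs p hp hp1 hp2,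
        ⟨Nat.floor_le h1.1, Nat.lt_floor_add_one _⟩, Nat.floor_le h2.1, Nat.lt_floor_add_one _⟩)
  calc volume S ≤ _ := measure_mono hcover
    _ ≤ _ := measure_union_le _ _
    _ ≤ _ := add_le_add (measure_union_le _ _) (measure_biUnion_finset_le _ _)
    _ = _ := by simp [Measure.volume_eq_prod, -Icc_prod_Icc]

theorem lattice_count_ge_area_sub (n : ℕ) (hn : 0 < n) (y h : ℝ)
    (hy0 : 0 ≤ y) (hy1 : y ≤ 1) :
    (volume {p : ℝ × ℝ | p.1 ∈ Icc (0:ℝ) n ∧ p.2 ∈ Icc (0:ℝ) n ∧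
        p.1 * y + p.2 * (1 - y) ≤ h}).toReal - 2 * n ≤
      ((Finset.Icc 1 n ×ˢ Finset.Icc 1 n).filter
        (fun p : ℕ × ℕ => (p.1 : ℝ) * y + (p.2 : ℝ) * (1 - y) ≤ h)).card := by
  set s := (Finset.Icc 1 n ×ˢ Finset.Icc 1 n).filter
    (fun p : ℕ × ℕ => (p.1 : ℝ) * y + (p.2 : ℝ) * (1 - y) ≤ h) with hs
  have hvol : volume {p : ℝ × ℝ | p.1 ∈ Icc (0:ℝ) n ∧ p.2 ∈ Icc (0:ℝ) n ∧
      p.1 * y + p.2 * (1 - y) ≤ h} ≤ ((n + n + s.card : ℕ) : ENNReal) := by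
    refine volume_le_card_add_of_floor_mem (fun p hp => ⟨hp.1, hp.2.1⟩) ?_
    rintro p ⟨h1, h2, hp⟩ hp1 hp2
    simp only [hs, Finset.mem_filter, Finset.mem_product, Finset.mem_Icc]
    refine ⟨⟨⟨Nat.le_floor (by simpa using hp1), Nat.floor_le_of_le h1.2⟩,
      Nat.le_floor (by simpa using hp2), Nat.floor_le_of_le h2.2⟩, le_trans ?_ hp⟩
    exact add_le_add (mul_le_mul_of_nonneg_right (Nat.floor_le h1.1) hy0)
      (mul_le_mul_of_nonneg_right (Nat.floor_le h2.1) (sub_nonneg.2 hy1))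
  have hreal := ENNReal.toReal_mono (ENNReal.natCast_ne_top _) hvol
  rw [ENNReal.toReal_natCast] at hreal
  push_cast at hreal
  linarith
end

section
/- Let n be a positive integer, let y be a real number with 0 ≤ y ≤ 1/2, and let h be a real number with n/2 ≤ h ≤ n. Then the number of pairs of integers (i, j) with 1 ≤ i ≤ n, 1 ≤ j ≤ n, and i·y + j·(1−y) ≤ h is at least n·h − 2·n. -/
theorem le_card_filter_natCast_le (n : ℕ) (l t : ℝ) (hln : l ≤ n) (hlt : l + 1 ≤ t) :
    l ≤ ((Finset.Icc 1 n).filter (fun j : ℕ => (j : ℝ) ≤ t)).card := by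
  rcases lt_or_ge t 0 with ht | ht
  · exact le_trans (by linarith) (Nat.cast_nonneg _)
  have hsub : Finset.Icc 1 (min n ⌊t⌋₊) ⊆
      (Finset.Icc 1 n).filter (fun j : ℕ => (j : ℝ) ≤ t) := by
    intro j hj
    rw [Finset.mem_Icc, le_min_iff] at hj
    rw [Finset.mem_filter, Finset.mem_Icc]
    exact ⟨⟨hj.1, hj.2.1⟩, (Nat.le_floor_iff ht).1 hj.2.2⟩
  have hcard := Finset.card_le_card hsub
  rw [Nat.card_Icc, Nat.add_sub_cancel] at hcard
  refine le_trans ?_ (Nat.cast_le.2 hcard)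
  rw [Nat.cast_min]
  exact le_min hln (by linarith [Nat.lt_floor_add_one t])

theorem sum_Icc_one_natCast (n : ℕ) :
    ∑ i ∈ Finset.Icc 1 n, (i : ℝ) = n * (n + 1) / 2 := by
  induction n with
  | zero => simp
  | succ k ih =>
    rw [Finset.sum_Icc_succ_top (by omega), ih]
    push_cast
    ring

/-- A lower bound for the number of lattice points below a line, from an affine lower bound
`a - i * b` for the number of points in each column `i`. -/
theorem le_card_lattice_of_affine (n : ℕ) (y h a b : ℝ) (hy : y < 1)
    (hn : ∀ i ∈ Finset.Icc 1 n, a - (i : ℝ) * b ≤ n)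
    (hline : ∀ i ∈ Finset.Icc 1 n, (a - (i : ℝ) * b + 1) * (1 - y) ≤ h - i * y) :
    n * a - n * (n + 1) / 2 * b ≤
      ((Finset.Icc 1 n ×ˢ Finset.Icc 1 n).filter
        (fun p : ℕ × ℕ => (p.1 : ℝ) * y + (p.2 : ℝ) * (1 - y) ≤ h)).card := by
  have hy' : 0 < 1 - y := by linarith
  have hcard : ((Finset.Icc 1 n ×ˢ Finset.Icc 1 n).filter
      (fun p : ℕ × ℕ => (p.1 : ℝ) * y + (p.2 : ℝ) * (1 - y) ≤ h)).card =
      ∑ i ∈ Finset.Icc 1 n,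
        ((Finset.Icc 1 n).filter (fun j : ℕ => (j : ℝ) ≤ (h - i * y) / (1 - y))).card := by
    simp only [Finset.card_filter, Finset.sum_product, le_div_iff₀ hy', le_sub_iff_add_le']
  have hsum : ∑ i ∈ Finset.Icc 1 n, (a - (i : ℝ) * b) = n * a - n * (n + 1) / 2 * b := by
    rw [Finset.sum_sub_distrib, ← Finset.sum_mul, sum_Icc_one_natCast]
    simp
  rw [hcard, ← hsum, Nat.cast_sum]
  exact Finset.sum_le_sum fun i hi =>
    le_card_filter_natCast_le n _ _ (hn i hi) ((le_div_iff₀ hy').2 (hline i hi))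

theorem lattice_count_ge (n : ℕ) (hn : 0 < n) (y h : ℝ)
    (hy0 : 0 ≤ y) (hy1 : y ≤ 1 / 2) (h1 : (n : ℝ) / 2 ≤ h) (h2 : h ≤ n) :
    (n : ℝ) * h - 2 * n ≤
      ((Finset.Icc 1 n ×ˢ Finset.Icc 1 n).filter
        (fun p : ℕ × ℕ => (p.1 : ℝ) * y + (p.2 : ℝ) * (1 - y) ≤ h)).card := by
  have hn1 : (1 : ℝ) ≤ n := by exact_mod_cast hn
  have hn0 : (0 : ℝ) < n := by linarith
  have hy' : 0 < 1 - y := by linarith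
  rcases le_total ((n + 1) * (1 - y)) h with hc | hc
  · refine le_trans ?_ (le_card_lattice_of_affine n y h n ((1 + 2 * (n - h)) / n)
      (by linarith) ?_ ?_)
    · have : (n : ℝ) * (n + 1) / 2 * ((1 + 2 * (n - h)) / n) =
          (n + 1) / 2 * (1 + 2 * (n - h)) := by
        field_simp
      rw [this]
      nlinarith
    · intro i _
      have : 0 ≤ (i : ℝ) * ((1 + 2 * (n - h)) / n) :=
        mul_nonneg (Nat.cast_nonneg _) (div_nonneg (by linarith) hn0.le)
      linarith
    · intro i hi
      have hin : (i : ℝ) ≤ n := by exact_mod_cast (Finset.mem_Icc.1 hi).2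
      obtain ⟨s, hs⟩ : ∃ s : ℝ, s = i / n := ⟨_, rfl⟩
      have hs0 : 0 ≤ s := hs ▸ by positivity
      have hs1 : s ≤ 1 := hs ▸ (div_le_one hn0).2 hin
      have his : (i : ℝ) = s * n := by rw [hs]; field_simp
      have hmul : (i : ℝ) * ((1 + 2 * (n - h)) / n) = s * (1 + 2 * (n - h)) := by
        rw [hs]; ring
      rw [hmul, his]
      have hleft := mul_nonneg (sub_nonneg.2 hs1) (sub_nonneg.2 hc)
      have hright := mul_nonneg hs0
        (mul_nonneg (sub_nonneg.2 h2) (by linarith : 0 ≤ 1 - 2 * y))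
      linarith
  · refine le_trans ?_ (le_card_lattice_of_affine n y h (h / (1 - y) - 1) (y / (1 - y))
      (by linarith) ?_ ?_)
    · have key : h - 1 ≤ (h - (n + 1) / 2 * y) / (1 - y) := by
        rw [le_div_iff₀ hy']
        nlinarith
      have := mul_le_mul_of_nonneg_left key hn0.le
      have e : (n : ℝ) * (h / (1 - y) - 1) - n * (n + 1) / 2 * (y / (1 - y)) =
          n * ((h - (n + 1) / 2 * y) / (1 - y)) - n := by ring
      rw [e]
      linarith
    · intro i _
      have hdiv : h / (1 - y) ≤ n + 1 := (div_le_iff₀ hy').2 hc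
      have : 0 ≤ (i : ℝ) * (y / (1 - y)) := by positivity
      linarith
    · intro i _
      apply le_of_eq
      field_simp
      ring
end
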